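/- For any positive integer k, there exist non-isomorphic graphs G' and G'' that are cospectral with respect to the adjacency matrix and satisfy Z(G') > Z(G'') + k. -/

import Mathlib

open SimpleGraph Matrix
open scoped Classical


/-- In the standard zero forcing process, a blue vertex `u` (in `B`) forces its unique
white neighbor `v`. -/
def StdForce {V : Type*} (G : SimpleGraph V) (B : Set V) (u v : V) : Prop :=
  u ∈ B ∧ v ∉ B ∧ G.Adj u v ∧ ∀ w, G.Adj u w → w ∉ B → w = v

/-- A set of blue vertices is closed (stalled) when no standard force is possible. -/
def ZFClosed {V : Type*} (G : SimpleGraph V) (B : Set V) : Prop :=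
  ∀ u v, StdForce G B u v → v ∈ B

/-- `S` is a zero forcing set: iterating the color change rule from `S` colors every
vertex blue; equivalently, the only stalled superset of `S` is the whole vertex set. -/
def IsZeroForcingSet {V : Type*} (G : SimpleGraph V) (S : Set V) : Prop :=
  ∀ B : Set V, S ⊆ B → ZFClosed G B → B = Set.univ

/-- The zero forcing number `Z(G)`. -/
noncomputable def zfNum {V : Type*} (G : SimpleGraph V) [Fintype V] : ℕ :=
  sInf {n | ∃ S : Finset V, IsZeroForcingSet G ↑S ∧ S.card = n}

/-- The graph on `Fin 6` whose edges are the given pairs. -/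
def graphOfPairs (L : Finset (Fin 6 × Fin 6)) (hL : ∀ a, (a, a) ∉ L) : SimpleGraph (Fin 6) where
  Adj a b := (a, b) ∈ L ∨ (b, a) ∈ L
  symm := ⟨fun _ _ h => h.symm⟩
  loopless := ⟨fun a h => hL a (h.elim id id)⟩

instance (L : Finset (Fin 6 × Fin 6)) (hL : ∀ a, (a, a) ∉ L) :
    DecidableRel (graphOfPairs L hL).Adj :=
  fun a b => inferInstanceAs (Decidable ((a, b) ∈ L ∨ (b, a) ∈ L))

/-- The disjoint union of the star `K_{1,3}` and an edge. -/
abbrev clawUnionEdge : SimpleGraph (Fin 6) :=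
  graphOfPairs {(0, 1), (0, 2), (0, 3), (4, 5)} (by decide)

/-- The disjoint union of the path on five vertices and an isolated vertex. -/
abbrev pathUnionPoint : SimpleGraph (Fin 6) :=
  graphOfPairs {(0, 1), (1, 2), (2, 3), (3, 4)} (by decide)

namespace Matrix

theorem charpoly_eq_of_mul_eq_mul {n R : Type*} [Fintype n] [DecidableEq n] [CommRing R]
    [IsDomain R] {A B P : Matrix n n R} (hP : P.det ≠ 0) (h : A * P = P * B) :
    A.charpoly = B.charpoly := by
  have hC : A.charmatrix * P.map Polynomial.C = P.map Polynomial.C * B.charmatrix := by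
    simp only [charmatrix, sub_mul, mul_sub, RingHom.mapMatrix_apply, ← Matrix.map_mul, h]
    rw [(scalar_commute _ (Commute.all _) _).eq]
  have hdet := congrArg det hC
  rw [det_mul, det_mul, mul_comm] at hdet
  refine mul_left_cancel₀ ?_ hdet
  rw [← RingHom.mapMatrix_apply, ← RingHom.map_det]
  exact Polynomial.C_ne_zero.mpr hP

theorem charpoly_blockDiagonal {n ι R : Type*} [Fintype n] [DecidableEq n] [Fintype ι]
    [DecidableEq ι] [CommRing R] (A : ι → Matrix n n R) :
    (blockDiagonal A).charpoly = ∏ i, (A i).charpoly := by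
  have h : (blockDiagonal A).charmatrix = blockDiagonal fun i => (A i).charmatrix := by
    ext1 ⟨a, i⟩ ⟨b, j⟩
    by_cases hij : i = j
    · subst hij
      by_cases hab : a = b <;> simp [blockDiagonal_apply, hab]
    · simp [blockDiagonal_apply, hij]
  simp only [charpoly, h, det_blockDiagonal]

end Matrix

namespace SimpleGraph

theorem adjMatrix_boxProd_bot {V ι R : Type*} [DecidableEq ι] [CommRing R]
    (G : SimpleGraph V) [DecidableRel G.Adj] [DecidableRel (G □ (⊥ : SimpleGraph ι)).Adj] :
    (G □ (⊥ : SimpleGraph ι)).adjMatrix R =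
      blockDiagonal fun _ => G.adjMatrix R := by
  ext ⟨a, i⟩ ⟨b, j⟩
  by_cases hij : i = j <;> simp [adjMatrix_apply, blockDiagonal_apply, boxProd_adj, hij]

theorem charpoly_adjMatrix_boxProd_bot {V ι : Type*} [Fintype V] [Fintype ι]
    [DecidableEq V] [DecidableEq ι] (G : SimpleGraph V) [DecidableRel G.Adj]
    [DecidableRel (G □ (⊥ : SimpleGraph ι)).Adj] : ((G □ (⊥ : SimpleGraph ι)).adjMatrix ℝ).charpoly =
      (G.adjMatrix ℝ).charpoly ^ Fintype.card ι := by
  rw [adjMatrix_boxProd_bot, Matrix.charpoly_blockDiagonal]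
  simp

theorem charpoly_adjMatrix_iso {V W : Type*} [Fintype V] [Fintype W] [DecidableEq V] [DecidableEq W]
    {G : SimpleGraph V} {H : SimpleGraph W} [DecidableRel G.Adj] [DecidableRel H.Adj]
    (e : G ≃g H) :
    (G.adjMatrix ℝ).charpoly = (H.adjMatrix ℝ).charpoly := by
  rw [← Matrix.charpoly_reindex e.toEquiv (G.adjMatrix ℝ)]
  congr 1
  ext a b
  have := e.symm.map_adj_iff (v := a) (w := b)
  simp only [reindex_apply, submatrix_apply, adjMatrix_apply]
  exact if_congr this rfl rfl

/-- An integer matrix with orthogonal rows intertwining the two adjacency matrices. -/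
def clawPathIntertwiner : Matrix (Fin 6) (Fin 6) ℤ :=
  !![0, 1, 0, 1, 0, 0;
     1, 0, 0, 0, 1, 0;
     0, 0, 1, 0, 0, 1;
     0, 0, 1, 0, 0, -1;
     1, 0, 0, 0, -1, 0;
     0, 1, 0, -1, 0, 0]

theorem charpoly_clawUnionEdge_eq :
    (clawUnionEdge.adjMatrix ℝ).charpoly = (pathUnionPoint.adjMatrix ℝ).charpoly := by
  have hmap : ∀ G : SimpleGraph (Fin 6), ∀ [DecidableRel G.Adj],
      G.adjMatrix ℝ = (Int.castRingHom ℝ).mapMatrix (G.adjMatrix ℤ) := by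
    intro G _
    ext a b
    simp only [adjMatrix_apply, RingHom.mapMatrix_apply, map_apply]
    split_ifs <;> simp
  have hmul : clawUnionEdge.adjMatrix ℤ * clawPathIntertwiner =
      clawPathIntertwiner * pathUnionPoint.adjMatrix ℤ := by decide +kernel
  have hsq : clawPathIntertwiner * clawPathIntertwinerᵀ =
      (2 : ℤ) • (1 : Matrix (Fin 6) (Fin 6) ℤ) := by decide +kernel
  have hdet : clawPathIntertwiner.det ≠ 0 := by
    intro h0
    have := congrArg det hsq
    rw [det_mul, h0, det_smul, det_one] at this
    norm_num at this
  have h := Matrix.charpoly_eq_of_mul_eq_mul hdet hmul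
  have key : ∀ G : SimpleGraph (Fin 6), ∀ [DecidableRel G.Adj],
      (G.adjMatrix ℝ).charpoly = (G.adjMatrix ℤ).charpoly.map (Int.castRingHom ℝ) := by
    intro G _
    rw [hmap, RingHom.mapMatrix_apply, Matrix.charpoly_map]
  have h' := congrArg (Polynomial.map (Int.castRingHom ℝ)) h
  rwa [← key, ← key] at h'

end SimpleGraph

theorem isZeroForcingSet_univ {V : Type*} (G : SimpleGraph V) :
    IsZeroForcingSet G Set.univ :=
  fun _ hB _ => Set.univ_subset_iff.mp hB

theorem zfNum_le_card {V : Type*} [Fintype V] {G : SimpleGraph V} {S : Finset V}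
    (hS : IsZeroForcingSet G ↑S) : zfNum G ≤ S.card :=
  Nat.sInf_le ⟨S, hS, rfl⟩

theorem exists_isZeroForcingSet_card_eq_zfNum {V : Type*} [Fintype V] (G : SimpleGraph V) :
    ∃ S : Finset V, IsZeroForcingSet G ↑S ∧ S.card = zfNum G :=
  Nat.sInf_mem (s := {n | ∃ S : Finset V, IsZeroForcingSet G ↑S ∧ S.card = n})
    ⟨_, Finset.univ, by simpa using isZeroForcingSet_univ G, rfl⟩

/-- A zero forcing set meets every fort: a nonempty set such that no vertex outside it has
exactly one neighbor in it. -/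
theorem IsZeroForcingSet.exists_mem_of_fort {V : Type*} {G : SimpleGraph V} {S F : Set V}
    (hS : IsZeroForcingSet G S) (hne : F.Nonempty)
    (hF : ∀ u ∉ F, ∀ v ∈ F, G.Adj u v → ∃ w ∈ F, G.Adj u w ∧ w ≠ v) : ∃ v ∈ F, v ∈ S := by
  by_contra! h
  have hcl : ZFClosed G Fᶜ := by
    rintro u v ⟨hu, hv, huv, huniq⟩
    obtain ⟨w, hw, huw, hwv⟩ := hF u hu v (not_not.mp hv) huv
    exact absurd (huniq w huw (not_not.mpr hw)) hwv
  have hc := hS Fᶜ (fun v hvS hvF => h v hvF hvS) hcl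
  obtain ⟨v, hv⟩ := hne
  exact (hc ▸ Set.mem_univ v : v ∈ Fᶜ) hv

theorem IsZeroForcingSet.preimage_iso {V W : Type*} {G : SimpleGraph V} {H : SimpleGraph W}
    (e : G ≃g H) {S : Set W} (hS : IsZeroForcingSet H S) : IsZeroForcingSet G (e ⁻¹' S) := by
  intro B hB hcl
  have h := hS (e.symm ⁻¹' B) (fun w hw => hB (by simpa using hw)) ?_
  · ext v
    simpa using Set.ext_iff.mp h (e v)
  · rintro u v ⟨hu, hv, huv, huniq⟩
    refine hcl (e.symm u) (e.symm v) ⟨hu, hv, e.symm.map_adj_iff.mpr huv, fun w huw hw => ?_⟩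
    rw [← huniq (e w) (by simpa using e.map_adj_iff.mpr huw) (by simpa using hw)]
    simp

theorem zfNum_le_of_iso {V W : Type*} [Fintype V] [Fintype W] {G : SimpleGraph V}
    {H : SimpleGraph W} (e : G ≃g H) : zfNum G ≤ zfNum H := by
  obtain ⟨S, hS, hcard⟩ := exists_isZeroForcingSet_card_eq_zfNum H
  have h : IsZeroForcingSet G ↑(S.map e.symm.toEquiv.toEmbedding) := by
    convert hS.preimage_iso e
    ext v
    simp [RelIso.symm_apply_eq]
  simpa [hcard] using zfNum_le_card h

theorem zfNum_eq_of_iso {V W : Type*} [Fintype V] [Fintype W] {G : SimpleGraph V}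
    {H : SimpleGraph W} (e : G ≃g H) : zfNum G = zfNum H :=
  (zfNum_le_of_iso e).antisymm (zfNum_le_of_iso e.symm)

theorem three_mul_le_zfNum_clawUnionEdge (m : ℕ) :
    3 * m ≤ zfNum (clawUnionEdge □ (⊥ : SimpleGraph (Fin m))) := by
  obtain ⟨S, hS, hcard⟩ :=
    exists_isZeroForcingSet_card_eq_zfNum (clawUnionEdge □ (⊥ : SimpleGraph (Fin m)))
  have hfort : ∀ (i : Fin m) (a b : Fin 6), a ≠ b →
      (∀ u, u ≠ a → u ≠ b → (clawUnionEdge.Adj u a ↔ clawUnionEdge.Adj u b)) →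
      (a, i) ∈ S ∨ (b, i) ∈ S := by
    intro i a b hab hadj
    obtain ⟨v, hvF, hvS⟩ := hS.exists_mem_of_fort (F := {(a, i), (b, i)}) ⟨_, Or.inl rfl⟩ (by
      rintro ⟨u, j⟩ hu v hv huv
      simp only [Set.mem_insert_iff, Set.mem_singleton_iff, Prod.mk.injEq, not_or] at hu hv
      rcases hv with rfl | rfl <;> simp only [boxProd_adj, bot_adj, false_and, or_false] at huv <;>
        obtain ⟨huv, rfl⟩ := huv
      · exact ⟨(b, j), by simp, by simpa using (hadj u (by tauto) (by tauto)).mp huv,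
          by simpa using hab.symm⟩
      · exact ⟨(a, j), by simp, by simpa using (hadj u (by tauto) (by tauto)).mpr huv,
          by simpa using hab⟩)
    rcases hvF with rfl | rfl
    · exact Or.inl hvS
    · exact Or.inr hvS
  have htransversal : ∀ T : Finset (Fin 6), (1 ∈ T ∨ 2 ∈ T) → (1 ∈ T ∨ 3 ∈ T) →
      (2 ∈ T ∨ 3 ∈ T) → (4 ∈ T ∨ 5 ∈ T) → 3 ≤ T.card := by decide +kernel
  have hfiber : ∀ i : Fin m, 3 ≤ (S.filter fun x => x.2 = i).card := by
    intro i
    have h := htransversal (Finset.univ.filter fun a => (a, i) ∈ S)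
      (by simpa using hfort i 1 2 (by decide) (by decide))
      (by simpa using hfort i 1 3 (by decide) (by decide))
      (by simpa using hfort i 2 3 (by decide) (by decide))
      (by simpa using hfort i 4 5 (by decide) (by decide))
    refine h.trans (Finset.card_le_card_of_injOn (fun a => (a, i)) ?_ ?_)
    · intro a ha
      simpa using ha
    · intro a _ b _ hab
      simpa using hab
  rw [← hcard, Finset.card_eq_sum_card_fiberwise (f := Prod.snd) (t := Finset.univ) (by simp)]
  calc 3 * m = ∑ _i : Fin m, 3 := by simp [mul_comm]
    _ ≤ _ := Finset.sum_le_sum fun i _ => hfiber i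

theorem zfNum_pathUnionPoint_le (m : ℕ) :
    zfNum (pathUnionPoint □ (⊥ : SimpleGraph (Fin m))) ≤ 2 * m := by
  have h : IsZeroForcingSet (pathUnionPoint □ (⊥ : SimpleGraph (Fin m)))
      ↑(({0, 5} : Finset (Fin 6)) ×ˢ (Finset.univ : Finset (Fin m))) := by
    intro B hB hcl
    have hstep : ∀ (i : Fin m) (a b : Fin 6), pathUnionPoint.Adj a b → (a, i) ∈ B →
        (∀ c, pathUnionPoint.Adj a c → c ≠ b → (c, i) ∈ B) → (b, i) ∈ B := by
      intro i a b hab ha hc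
      by_contra hb
      refine hb (hcl (a, i) (b, i) ⟨ha, hb, by simpa using hab, ?_⟩)
      rintro ⟨c, j⟩ hac hcB
      simp only [boxProd_adj, bot_adj, false_and, or_false] at hac
      obtain ⟨hac, rfl⟩ := hac
      by_contra hne
      exact hcB (hc c hac (by simpa using hne))
    ext ⟨a, i⟩
    simp only [Set.mem_univ, iff_true]
    have h0 : ((0 : Fin 6), i) ∈ B := hB (by simp)
    have h5 : ((5 : Fin 6), i) ∈ B := hB (by simp)
    have h1 := hstep i 0 1 (by decide) h0 fun c hc hne =>
      absurd hc (by revert c; decide)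
    have h2 := hstep i 1 2 (by decide) h1 fun c hc hne => by
      rwa [show c = 0 by revert c; decide]
    have h3 := hstep i 2 3 (by decide) h2 fun c hc hne => by
      rwa [show c = 1 by revert c; decide]
    have h4 := hstep i 3 4 (by decide) h3 fun c hc hne => by
      rwa [show c = 2 by revert c; decide]
    fin_cases a <;> assumption
  refine (zfNum_le_card h).trans ?_
  simp

/-- Cospectral graphs with different zero forcing numbers can be relabelled by `Fin n`. -/
theorem exists_fin_cospectral_of_zfNum_gap {V : Type*} [Fintype V] [DecidableEq V]
    {G H : SimpleGraph V} [DecidableRel G.Adj] [DecidableRel H.Adj] {k : ℕ}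
    (hchar : (G.adjMatrix ℝ).charpoly = (H.adjMatrix ℝ).charpoly)
    (hgap : zfNum G > zfNum H + k) :
    ∃ (n : ℕ) (G' G'' : SimpleGraph (Fin n)),
      ¬ Nonempty (G' ≃g G'') ∧
      (G'.adjMatrix ℝ).charpoly = (G''.adjMatrix ℝ).charpoly ∧
      zfNum G' > zfNum G'' + k := by
  let e := Fintype.equivFin V
  have hgap' : zfNum (G.map e) > zfNum (H.map e) + k := by
    rwa [← zfNum_eq_of_iso (Iso.map e G), ← zfNum_eq_of_iso (Iso.map e H)]
  refine ⟨_, G.map e, H.map e, ?_, ?_, hgap'⟩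
  · rintro ⟨f⟩
    have := zfNum_eq_of_iso f
    omega
  · have h : ∀ [DecidableRel (G.map e).Adj] [DecidableRel (H.map e).Adj],
        ((G.map e).adjMatrix ℝ).charpoly = ((H.map e).adjMatrix ℝ).charpoly := by
      intro _ _
      exact (charpoly_adjMatrix_iso (Iso.map e G)).symm.trans
        (hchar.trans (charpoly_adjMatrix_iso (Iso.map e H)))
    exact @h (fun _ _ => Classical.propDecidable _) (fun _ _ => Classical.propDecidable _)

/-- For any positive integer `k` there exist non-isomorphic adjacency-cospectral graphs
`G'` and `G''` with `Z(G') > Z(G'') + k`. -/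
theorem exists_cospectral_with_large_zf_gap (k : ℕ) (hk : 0 < k) :
    ∃ (n : ℕ) (G' G'' : SimpleGraph (Fin n)),
      ¬ Nonempty (G' ≃g G'') ∧
      (G'.adjMatrix ℝ).charpoly = (G''.adjMatrix ℝ).charpoly ∧
      zfNum G' > zfNum G'' + k := by
  refine exists_fin_cospectral_of_zfNum_gap
    (G := clawUnionEdge □ (⊥ : SimpleGraph (Fin (k + 1))))
    (H := pathUnionPoint □ (⊥ : SimpleGraph (Fin (k + 1)))) ?_ ?_
  · rw [charpoly_adjMatrix_boxProd_bot, charpoly_adjMatrix_boxProd_bot, charpoly_clawUnionEdge_eq]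
  · have h₁ := three_mul_le_zfNum_clawUnionEdge (k + 1)
    have h₂ := zfNum_pathUnionPoint_le (k + 1)
    omega
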